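/- For every 1 ≤ r < m, the F_q-linear span in k[P] of the characteristic functions χ_W, as W ranges over all totally isotropic r-dimensional subspaces of V, equals the F_q-linear span in k[P] of the characteristic functions χ_U, as U ranges over all r-dimensional subspaces of V. -/

import Mathlib

open scoped Classical

noncomputable section

/-- The characteristic function (in `k[P]`, `P` the set of `1`-dimensional subspaces
of `V`) of a subspace `W ⊆ V`: `χ_W(Z) = 1` if `Z ⊆ W`, else `0`. -/
def chiFun {k V : Type*} [Field k] [AddCommGroup V] [Module k V]
    (W : Submodule k V) :
    {Z : Submodule k V // Module.finrank k Z = 1} → k :=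
  fun Z => if Z.val ≤ W then 1 else 0

set_option linter.unusedSectionVars false
set_option linter.unusedSimpArgs false


/-- the exponent vector `(p-1,...,p-1)` -/
def topE (N p : ℕ) : Fin N →₀ ℕ := Finsupp.equivFunOnFinite.symm (fun _ => p - 1)

lemma topE_apply (N p : ℕ) (i : Fin N) : topE N p i = p - 1 := rfl

lemma digits_lemma (p N : ℕ) (hp : 2 ≤ p) : ∀ (t : ℕ) (a : Fin t → Fin N → ℕ),
    (∀ l, ∑ i, a l i ≤ N * (p - 1)) → (∀ i, ∑ l, a l i * p ^ (l : ℕ) = p ^ t - 1) →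
    ∀ l i, a l i = p - 1 := by
  intro t
  induction t with
  | zero => intro a _ _ l; exact l.elim0
  | succ t ih =>
    intro a h1 h2
    have h3 : ∀ i, a 0 i + p * ∑ l : Fin t, a l.succ i * p ^ (l : ℕ) + 1 = p * p ^ t := by
      intro i
      have := h2 i
      rw [Fin.sum_univ_succ] at this
      have hpos : 1 ≤ p ^ (t+1) := Nat.one_le_pow _ _ (by omega)
      have e : ∑ l : Fin t, a l.succ i * p ^ ((l.succ : Fin (t+1)) : ℕ) = p * ∑ l : Fin t, a l.succ i * p ^ (l : ℕ) := by
        rw [Finset.mul_sum]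
        refine Finset.sum_congr rfl fun l _ => ?_
        simp [pow_succ]; ring
      rw [e] at this
      simp only [Fin.val_zero, pow_zero, mul_one] at this
      rw [pow_succ'] at this hpos
      omega
    have h4 : ∀ i, p - 1 ≤ a 0 i := by
      intro i
      have : p ∣ a 0 i + 1 := by
        have hd : p ∣ p * ∑ l : Fin t, a l.succ i * p ^ (l : ℕ) := dvd_mul_right _ _
        have hd2 : p ∣ (a 0 i + 1) + p * ∑ l : Fin t, a l.succ i * p ^ (l : ℕ) := by
          have := h3 i
          refine ⟨p ^ t, ?_⟩
          omega
        exact (Nat.dvd_add_left hd).mp hd2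
      have := Nat.le_of_dvd (by omega) this
      omega
    have h5 : ∀ i, a 0 i = p - 1 := by
      have : ∑ i : Fin N, (p - 1) = ∑ i, a 0 i := by
        apply le_antisymm
        · exact Finset.sum_le_sum fun i _ => h4 i
        · simpa using h1 0
      have := (Finset.sum_eq_sum_iff_of_le (fun i _ => h4 i)).mp this
      intro i; exact (this i (Finset.mem_univ _)).symm
    have h6 := ih (fun l i => a l.succ i) (fun l => h1 l.succ) (by
      intro i
      have := h3 i
      rw [h5 i] at this
      have e : p * (∑ l : Fin t, a l.succ i * p ^ (l : ℕ) + 1) = p * p ^ t := by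
        rw [mul_add]; omega
      have := Nat.eq_of_mul_eq_mul_left (by omega) e
      omega)
    intro l
    refine Fin.cases ?_ ?_ l
    · exact h5
    · exact h6

section
variable {k : Type*} [Field k] [Fintype k] (p t : ℕ) [Fact p.Prime] [CharP k p]

lemma geom_e (hp : 2 ≤ p) : (∑ l : Fin t, p ^ (l : ℕ)) * (p - 1) = p ^ t - 1 := by
  rw [Fin.sum_univ_eq_sum_range (fun l => p ^ l) t]
  have := Nat.geomSum_eq hp t
  rw [this]
  apply Nat.div_mul_cancel
  simpa using Nat.sub_dvd_pow_sub_pow p 1 t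

/-- Chevalley–Warning type evaluation. -/
lemma sum_eval_pow (hk : Fintype.card k = p ^ t) (N : ℕ) (g : MvPolynomial (Fin N) k)
    (hg : g.totalDegree ≤ N * (p - 1)) :
    ∑ v : Fin N → k, (MvPolynomial.eval v g) ^ (∑ l : Fin t, p ^ (l : ℕ)) =
      (-1) ^ N * (g.coeff (topE N p)) ^ (∑ l : Fin t, p ^ (l : ℕ)) := by
  have hp2 : 2 ≤ p := (Fact.out : p.Prime).two_le
  have hcard : Fintype.card k = p ^ t := hk
  let C : (Fin t → (Fin N →₀ ℕ)) → k := fun J => ∏ l, (g.coeff (J l)) ^ p ^ (l : ℕ)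
  let E : (Fin t → (Fin N →₀ ℕ)) → Fin N → ℕ := fun J i => ∑ l, J l i * p ^ (l : ℕ)
  have h1 : ∀ v : Fin N → k, (MvPolynomial.eval v g) ^ (∑ l : Fin t, p ^ (l : ℕ)) =
      ∑ J ∈ Fintype.piFinset (fun _ : Fin t => g.support), C J * ∏ i, v i ^ E J i := by
    intro v
    rw [← Finset.prod_pow_eq_pow_sum]
    have : ∀ l : Fin t, (MvPolynomial.eval v g) ^ p ^ (l : ℕ) =
        ∑ m ∈ g.support, (g.coeff m * ∏ i, v i ^ m i) ^ p ^ (l : ℕ) := by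
      intro l
      rw [MvPolynomial.eval_eq', sum_pow_char_pow]
    rw [Finset.prod_congr rfl fun l _ => this l, Finset.prod_univ_sum]
    refine Finset.sum_congr rfl fun J _ => ?_
    simp only [mul_pow, Finset.prod_mul_distrib, C, E]
    congr 1
    simp only [← Finset.prod_pow]
    rw [Finset.prod_comm]
    refine Finset.prod_congr rfl fun i _ => ?_
    rw [← Finset.prod_pow_eq_pow_sum]
    simp only [pow_mul]
  simp only [h1]
  rw [Finset.sum_comm]
  have h2 : ∀ J : Fin t → (Fin N →₀ ℕ), ∑ v : Fin N → k, C J * ∏ i, v i ^ E J i =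
      C J * ∏ i, ∑ x : k, x ^ E J i := by
    intro J
    rw [← Finset.mul_sum, Finset.prod_univ_sum, Fintype.piFinset_univ]
  simp only [h2]
  have hqsum : ∑ x : k, x ^ (p ^ t - 1) = -1 := by
    have := FiniteField.sum_pow_units k (p ^ t - 1)
    rw [hcard] at this
    simp only [dvd_refl, if_true] at this
    by_cases h0 : p ^ t - 1 = 0
    · have h3 : 1 < Fintype.card k := Fintype.one_lt_card
      omega
    rw [← this, ← Finset.sum_erase_add _ _ (Finset.mem_univ (0:k))]
    simp only [ne_eq, h0, not_false_eq_true, zero_pow, add_zero]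
    symm
    refine Finset.sum_bij (fun u _ => (u : k)) ?_ ?_ ?_ ?_
    · intro u _; simp
    · intro u _ v _ h; exact Units.ext h
    · intro b hb; simp at hb; exact ⟨Units.mk0 b hb, by simp, rfl⟩
    · intro u _; simp
  have h3 : ∀ J ∈ Fintype.piFinset (fun _ : Fin t => g.support), J ≠ (fun _ => topE N p) →
      C J * ∏ i, ∑ x : k, x ^ E J i = 0 := by
    intro J hJ hne
    by_contra hcon
    apply hne
    have hprod : ∀ i, ∑ x : k, x ^ E J i ≠ 0 := by
      intro i hi
      exact hcon (by rw [Finset.prod_eq_zero (Finset.mem_univ i) hi, mul_zero])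
    have hge : ∀ i, p ^ t - 1 ≤ E J i := by
      intro i
      by_contra hlt
      exact hprod i (FiniteField.sum_pow_lt_card_sub_one k (E J i) (by rw [hcard]; omega))
    have hdeg : ∀ l, ∑ i, J l i ≤ N * (p - 1) := by
      intro l
      have hm : J l ∈ g.support := Fintype.mem_piFinset.mp hJ l
      have := MvPolynomial.le_totalDegree hm
      rw [Finsupp.sum_fintype _ _ (fun _ => rfl)] at this
      exact this.trans hg
    have heq : ∀ i, E J i = p ^ t - 1 := by
      have : ∑ i : Fin N, (p ^ t - 1) = ∑ i, E J i := by
        apply le_antisymm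
        · exact Finset.sum_le_sum fun i _ => hge i
        · simp only [E]
          rw [Finset.sum_comm]
          simp only [← Finset.sum_mul]
          calc ∑ l : Fin t, (∑ i, J l i) * p ^ (l : ℕ) ≤ ∑ l : Fin t, (N * (p - 1)) * p ^ (l : ℕ) :=
                Finset.sum_le_sum fun l _ => Nat.mul_le_mul_right _ (hdeg l)
            _ = N * (p ^ t - 1) := by
                rw [← Finset.mul_sum, ← geom_e p t hp2]; ring
            _ = _ := by simp
      have := (Finset.sum_eq_sum_iff_of_le (fun i _ => hge i)).mp this
      intro i; exact (this i (Finset.mem_univ _)).symm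
    have := digits_lemma p N hp2 t (fun l i => J l i) hdeg heq
    funext l
    ext i
    rw [this l i, topE_apply]
  have h4 : C (fun _ => topE N p) * ∏ i, ∑ x : k, x ^ E (fun _ => topE N p) i =
      (-1) ^ N * (g.coeff (topE N p)) ^ (∑ l : Fin t, p ^ (l : ℕ)) := by
    have : ∀ i, E (fun _ => topE N p) i = p ^ t - 1 := by
      intro i
      simp only [E, topE_apply]
      rw [← Finset.mul_sum, ← geom_e p t hp2]; ring
    simp only [this, hqsum, C]
    rw [Finset.prod_pow_eq_pow_sum]
    simp [mul_comm]
  rw [← h4]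
  by_cases hmem : topE N p ∈ g.support
  · refine Finset.sum_eq_single_of_mem _ ?_ h3
    simp [Fintype.mem_piFinset, MvPolynomial.mem_support_iff.mp hmem]
  · rw [h4]
    have hc : g.coeff (topE N p) = 0 := by simpa using hmem
    have ht : t ≠ 0 := by
      rintro rfl
      have h3 : 1 < Fintype.card k := Fintype.one_lt_card
      simp [hcard] at h3
    have he : (∑ l : Fin t, p ^ (l : ℕ)) ≠ 0 := by
      intro h
      have := geom_e p t hp2
      rw [h] at this
      have : 1 < p ^ t := Nat.one_lt_pow ht (by omega)
      omega
    rw [hc, zero_pow he, mul_zero]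
    refine Finset.sum_eq_zero fun J hJ => h3 J hJ ?_
    rintro rfl
    exact hmem (Fintype.mem_piFinset.mp hJ ⟨0, Nat.pos_of_ne_zero ht⟩)

/-- substitution of the rows of a matrix -/
def subst {N : ℕ} (A : Matrix (Fin N) (Fin N) k) :
    MvPolynomial (Fin N) k →ₐ[k] MvPolynomial (Fin N) k :=
  MvPolynomial.aeval (fun i => ∑ j, MvPolynomial.C (A i j) * MvPolynomial.X j)

lemma subst_X {N : ℕ} (A : Matrix (Fin N) (Fin N) k) (i : Fin N) :
    subst A (MvPolynomial.X i) = ∑ j, MvPolynomial.C (A i j) * MvPolynomial.X j := by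
  simp [subst]

lemma subst_C {N : ℕ} (A : Matrix (Fin N) (Fin N) k) (c : k) :
    subst A (MvPolynomial.C c) = MvPolynomial.C c := by
  simp [subst, MvPolynomial.algebraMap_eq]

lemma subst_mul {N : ℕ} (A A' : Matrix (Fin N) (Fin N) k) (g : MvPolynomial (Fin N) k) :
    subst (A * A') g = subst A' (subst A g) := by
  suffices h : subst (A * A') = (subst A').comp (subst A) by rw [h]; rfl
  apply MvPolynomial.algHom_ext
  intro i
  simp only [AlgHom.comp_apply, subst_X, map_sum, map_mul, subst_C, Matrix.mul_apply, Finset.sum_mul,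
    Finset.mul_sum]
  rw [Finset.sum_comm]
  refine Finset.sum_congr rfl fun a _ => Finset.sum_congr rfl fun b _ => by ring

lemma coeff_subst {N : ℕ} (A : Matrix (Fin N) (Fin N) k) : ∀ (g : MvPolynomial (Fin N) k),
    (subst A g).coeff (topE N p) = A.det ^ (p - 1) * g.coeff (topE N p) := by
  have hp2 : 2 ≤ p := (Fact.out : p.Prime).two_le
  have key : ∀ A : Matrix (Fin N) (Fin N) k, (∀ m : Fin N →₀ ℕ,
      (∏ i, (∑ j, MvPolynomial.C (A i j) * MvPolynomial.X j) ^ m i : MvPolynomial (Fin N) k).coeff (topE N p)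
       = A.det ^ (p-1) * if m = topE N p then 1 else 0) → 
      ∀ (g : MvPolynomial (Fin N) k),
    (subst A g).coeff (topE N p) = A.det ^ (p - 1) * g.coeff (topE N p) := by
    intro A hA g
    induction g using MvPolynomial.induction_on' with
    | monomial m a =>
      have : subst A (MvPolynomial.monomial m a) = MvPolynomial.C a * ∏ i, (∑ j, MvPolynomial.C (A i j) * MvPolynomial.X j) ^ m i := by
        rw [subst, MvPolynomial.aeval_monomial, MvPolynomial.algebraMap_eq, Finsupp.prod_fintype _ _ (by simp)]
      rw [this, MvPolynomial.coeff_C_mul, hA, MvPolynomial.coeff_monomial]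
      split_ifs <;> ring
    | add a b ha hb => rw [map_add, MvPolynomial.coeff_add, ha, hb, MvPolynomial.coeff_add]; ring
  refine Matrix.diagonal_transvection_induction (fun A => ∀ (g : MvPolynomial (Fin N) k),
    (subst A g).coeff (topE N p) = A.det ^ (p - 1) * g.coeff (topE N p)) A ?_ ?_ ?_
  · intro D _
    apply key
    intro m
    have : ∀ i, ∑ j, MvPolynomial.C (Matrix.diagonal D i j) * MvPolynomial.X j = (MvPolynomial.C (D i) * MvPolynomial.X i : MvPolynomial (Fin N) k) := by
      intro i
      rw [Finset.sum_eq_single i]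
      · simp
      · intro b _ hb; rw [Matrix.diagonal_apply_ne' _ hb]; simp
      · simp
    simp only [this, mul_pow, Finset.prod_mul_distrib, Matrix.det_diagonal]
    have e : (∏ i, MvPolynomial.X i ^ m i : MvPolynomial (Fin N) k) = MvPolynomial.monomial m 1 := by
      rw [MvPolynomial.monomial_eq, Finsupp.prod_fintype _ _ (by simp)]; simp
    rw [e]
    simp only [← MvPolynomial.C_pow, ← map_prod]
    rw [MvPolynomial.coeff_C_mul, MvPolynomial.coeff_monomial]
    split_ifs with h
    · rw [h]; simp only [topE_apply]; rw [Finset.prod_pow]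
    · simp
  · intro T
    apply key
    obtain ⟨i, j, hij, c⟩ := T
    intro m
    simp only [Matrix.TransvectionStruct.toMatrix, Matrix.det_transvection_of_ne i j hij, one_pow, one_mul]
    have e1 : ∀ l, l ≠ i → ∑ j', MvPolynomial.C (Matrix.transvection i j c l j') * MvPolynomial.X j' = (MvPolynomial.X l : MvPolynomial (Fin N) k) := by
      intro l hl
      rw [Finset.sum_eq_single l]
      · simp [Matrix.transvection, Matrix.single_apply, hl.symm]
      · intro b _ hb; simp [Matrix.transvection, Matrix.single_apply, hl.symm, Matrix.one_apply_ne' hb]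
      · simp
    have e2 : ∑ j', MvPolynomial.C (Matrix.transvection i j c i j') * MvPolynomial.X j' = (MvPolynomial.X i + MvPolynomial.C c * MvPolynomial.X j : MvPolynomial (Fin N) k) := by
      simp only [Matrix.transvection, Matrix.add_apply, map_add, add_mul, Finset.sum_add_distrib]
      congr 1
      · rw [Finset.sum_eq_single i]
        · simp
        · intro b _ hb; simp [Matrix.one_apply_ne' hb]
        · simp
      · rw [Finset.sum_eq_single j]
        · simp [Matrix.single_apply]
        · intro b _ hb; simp [Matrix.single_apply, hb.symm]
        · simp
    have e3 : (∏ l, (∑ j', MvPolynomial.C (Matrix.transvection i j c l j') * MvPolynomial.X j') ^ m l : MvPolynomial (Fin N) k) =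
       ∑ r ∈ Finset.range (m i + 1), MvPolynomial.monomial (m.erase i + Finsupp.single i r + Finsupp.single j (m i - r)) (c ^ (m i - r) * ((m i).choose r : k)) := by
      rw [← Finset.mul_prod_erase _ _ (Finset.mem_univ i), e2, add_pow, Finset.sum_mul]
      refine Finset.sum_congr rfl fun r _ => ?_
      have : ∏ l ∈ Finset.univ.erase i, (∑ j', MvPolynomial.C (Matrix.transvection i j c l j') * MvPolynomial.X j') ^ m l = MvPolynomial.monomial (m.erase i) (1:k) := by
        rw [MvPolynomial.monomial_eq, Finsupp.prod_fintype _ _ (by simp), ← Finset.mul_prod_erase _ _ (Finset.mem_univ i)]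
        simp only [Finsupp.erase_same, pow_zero, one_mul, map_one]
        refine Finset.prod_congr rfl fun l hl => ?_
        have hl' : l ≠ i := by simpa using hl
        rw [e1 l hl', Finsupp.erase_ne hl']
      rw [this]
      rw [mul_pow, ← MvPolynomial.C_pow]
      rw [show ((m i).choose r : MvPolynomial (Fin N) k) = MvPolynomial.C ((m i).choose r : k) by simp]
      rw [MvPolynomial.X_pow_eq_monomial, MvPolynomial.X_pow_eq_monomial]
      simp only [MvPolynomial.C_apply, MvPolynomial.monomial_mul]
      congr 1
      · congr 1; simp only [zero_add, add_zero]; abel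
      · ring
    rw [e3, MvPolynomial.coeff_sum]
    simp only [MvPolynomial.coeff_monomial]
    by_cases hm : m = topE N p
    · rw [if_pos hm, Finset.sum_eq_single (m i)]
      · simp [hm, Finsupp.erase_add_single]
      · intro r hr hne
        rw [if_neg]
        intro h
        have := DFunLike.congr_fun h i
        simp [Finsupp.single_apply, hij.symm, hm, topE_apply] at this
        rw [hm, topE_apply] at hne
        exact hne this
      · simp
    · rw [if_neg hm]
      refine Finset.sum_eq_zero fun r hr => ?_
      split_ifs with h
      · have hi := DFunLike.congr_fun h i
        have hj := DFunLike.congr_fun h j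
        simp [Finsupp.single_apply, hij, hij.symm, topE_apply, Finsupp.erase_ne] at hi hj
        have hr' : r ≤ m i := by simp at hr; omega
        by_cases hrm : r = m i
        · exfalso
          apply hm
          rw [← h, hrm]
          simp [Finsupp.erase_add_single]
        · have : (p : ℕ) ∣ (m i).choose r := by
            have := Nat.Prime.dvd_choose_add (p := p) (a := r) (b := m i - r) (Fact.out : p.Prime) (by omega) (by omega) (by omega)
            rwa [Nat.add_sub_cancel' hr'] at this
          rw [(CharP.cast_eq_zero_iff k p _).mpr this, mul_zero]
      · rfl
  · intro A A' hA hA' g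
    rw [subst_mul, hA', hA, Matrix.det_mul]; ring

lemma coeff_prod_lin {N : ℕ} (A : Matrix (Fin N) (Fin N) k) :
    (∏ i, (∑ j, MvPolynomial.C (A i j) * MvPolynomial.X j) ^ (p - 1) : MvPolynomial (Fin N) k).coeff (topE N p)
      = A.det ^ (p - 1) := by
  have := coeff_subst p A (∏ i, MvPolynomial.X i ^ (p - 1))
  simp only [map_prod, map_pow, subst_X] at this
  rw [this]
  have e : (∏ i, MvPolynomial.X i ^ (p - 1) : MvPolynomial (Fin N) k) = MvPolynomial.monomial (topE N p) 1 := by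
    rw [MvPolynomial.monomial_eq, Finsupp.prod_fintype _ _ (by simp)]; simp [topE_apply]
  rw [e, MvPolynomial.coeff_monomial]; simp
end


section
variable {k : Type*} [Field k] [Fintype k] (p t : ℕ) [Fact p.Prime] [CharP k p]
open MvPolynomial

def lin (a : Fin 6 → k) : MvPolynomial (Fin 6) k := ∑ j, C (a j) * X j

lemma eval_lin (a v : Fin 6 → k) : eval v (lin a) = a ⬝ᵥ v := by
  simp [lin, dotProduct]

lemma totalDegree_lin (a : Fin 6 → k) : (lin a).totalDegree ≤ 1 := by
  refine totalDegree_finsetSum_le fun i _ => ?_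
  refine (totalDegree_mul _ _).trans ?_
  simp

def Bvec (z : Fin 6 → k) : Fin 6 → k := ![-z 1, z 0, -z 3, z 2, -z 5, z 4]

def B6 (u v : Fin 6 → k) : k := Bvec u ⬝ᵥ v

lemma B6_eq (u v : Fin 6 → k) :
    B6 u v = u 0 * v 1 - u 1 * v 0 + (u 2 * v 3 - u 3 * v 2) + (u 4 * v 5 - u 5 * v 4) := by
  simp [B6, Bvec, dotProduct, Fin.sum_univ_six]; ring

lemma B6_symm (u v : Fin 6 → k) : B6 u v = - B6 v u := by
  rw [B6_eq, B6_eq]; ring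

def Good (T : (Fin 6 → k) → k) : Prop :=
  ∃ P : (Fin 6 → k) → MvPolynomial (Fin 6) k,
    (∀ z, (P z).totalDegree ≤ 4 * (p - 1)) ∧
    (∀ u v a b c d, eval (c • u + d • v) (P (a • u + b • v)) =
      (a * d - b * c) ^ (4 * (p - 1)) * eval v (P u)) ∧
    (∀ z μ, (P z * lin (Bvec z) ^ (p - 1) * lin μ ^ (p - 1)).coeff (topE 6 p) =
      (μ ⬝ᵥ z) ^ (p - 1) * T z)

/-- the hypotheses on the function `φ` -/
structure Adm (φ : (Fin 6 → k) → k) : Prop where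
  zero : φ 0 = 0
  homog : ∀ (c : k) z, c ≠ 0 → φ (c • z) = φ z
  plane : ∀ u v, LinearIndependent k ![u, v] → B6 u v = 0 → ∑ x : k, ∑ y : k, φ (x • u + y • v) = 0

lemma sum_units_const (c : k) : ∑ y : k, (if y = 0 then 0 else c) = -c := by
  have h : ∀ y : k, (if y = 0 then 0 else c) = c - if y = 0 then c else 0 := by
    intro y; split_ifs <;> simp
  simp only [h, Finset.sum_sub_distrib]
  simp [FiniteField.cast_card_eq_zero k]

lemma plane_formula {φ : (Fin 6 → k) → k} (hz : φ 0 = 0)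
    (hh : ∀ (c : k) z, c ≠ 0 → φ (c • z) = φ z) (u v : Fin 6 → k) :
    ∑ x : k, ∑ y : k, φ (x • u + y • v) = -(φ u + ∑ c : k, φ (v + c • u)) := by
  rw [Finset.sum_comm]
  have h1 : ∀ y : k, y ≠ 0 → ∑ x : k, φ (x • u + y • v) = ∑ c : k, φ (v + c • u) := by
    intro y hy
    symm
    refine Fintype.sum_equiv (Equiv.mulLeft₀ y hy) _ _ fun c => ?_
    rw [← hh y _ hy]
    congr 1
    simp [smul_smul, add_comm]
  have h0 : ∑ x : k, φ (x • u + (0:k) • v) = - φ u := by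
    rw [← sum_units_const]
    refine Finset.sum_congr rfl fun x _ => ?_
    split_ifs with h
    · simp [h, hz]
    · simp [hh x u h]
  have h2 : ∀ y : k, ∑ x : k, φ (x • u + y • v) = (if y = 0 then - φ u else 0) + (if y = 0 then 0 else ∑ c : k, φ (v + c • u)) := by
    intro y
    split_ifs with h
    · rw [h, h0, add_zero]
    · rw [h1 y h, zero_add]
  simp only [h2, Finset.sum_add_distrib, sum_units_const]
  simp; ring

lemma exp_pos (hk : Fintype.card k = p ^ t) : (∑ l : Fin t, p ^ (l : ℕ)) ≠ 0 := by
  have hp2 : 2 ≤ p := (Fact.out : p.Prime).two_le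
  intro h
  have h1 := geom_e p t hp2
  rw [h] at h1
  have h3 : 1 < Fintype.card k := Fintype.one_lt_card
  omega

lemma indicator_pow (hk : Fintype.card k = p ^ t) (b : k) :
    (if b = 0 then (1:k) else 0) = 1 - (b ^ (p - 1)) ^ (∑ l : Fin t, p ^ (l : ℕ)) := by
  have hp2 : 2 ≤ p := (Fact.out : p.Prime).two_le
  rw [← pow_mul, mul_comm, geom_e p t hp2]
  have h3 : 1 < Fintype.card k := Fintype.one_lt_card
  split_ifs with h
  · rw [h, zero_pow (by omega), sub_zero]
  · rw [← hk, FiniteField.pow_card_sub_one_eq_one b h, sub_self]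

lemma sum_eval_pow_zero (hk : Fintype.card k = p ^ t) (g : MvPolynomial (Fin 6) k)
    (hg : g.totalDegree < 6 * (p - 1)) :
    ∑ v : Fin 6 → k, (eval v g) ^ (∑ l : Fin t, p ^ (l : ℕ)) = 0 := by
  rw [sum_eval_pow p t hk 6 g hg.le, coeff_eq_zero_of_totalDegree_lt, zero_pow (exp_pos p t hk), mul_zero]
  rw [show ∑ i ∈ (topE 6 p).support, topE 6 p i = (topE 6 p).sum (fun _ e => e) from rfl, Finsupp.sum_fintype _ _ (fun _ => rfl)]
  simpa [topE_apply] using hg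

lemma good_sum (hk : Fintype.card k = p ^ t) {φ : (Fin 6 → k) → k} (hφ : Adm φ)
    {T : (Fin 6 → k) → k} (hT : Good p T) :
    ∑ z, φ z * (T z) ^ (∑ l : Fin t, p ^ (l : ℕ)) = 0 := by
  have hp2 : 2 ≤ p := (Fact.out : p.Prime).two_le
  obtain ⟨P, hdeg, hinv, hco⟩ := hT
  set e := ∑ l : Fin t, p ^ (l : ℕ) with he
  have he0 : e ≠ 0 := exp_pos p t hk
  let W : (Fin 6 → k) → (Fin 6 → k) → k := fun u v => (eval v (P u)) ^ e
  have hWdep : ∀ (u v : Fin 6 → k) (a b c d : k), a * d - b * c = 0 → W (a • u + b • v) (c • u + d • v) = 0 := by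
    intro u v a b c d h
    simp only [W, hinv, h]
    rw [zero_pow (by omega), zero_mul, zero_pow he0]
  have hWinv : ∀ (u v : Fin 6 → k) (a b c d : k), a * d - b * c ≠ 0 → W (a • u + b • v) (c • u + d • v) = W u v := by
    intro u v a b c d h
    simp only [W, hinv]
    rw [mul_pow, ← pow_mul, show 4 * (p - 1) * e = (e * (p - 1)) * 4 by ring, geom_e p t hp2, ← hk, pow_mul,
      FiniteField.pow_card_sub_one_eq_one _ h, one_pow, one_mul]
  have hW0 : ∀ v, W 0 v = 0 := by
    intro v
    have := hWdep 0 v 0 0 0 1 (by simp)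
    simpa using this
  have hWsm : ∀ v (c : k), W v (c • v) = 0 := by
    intro v c
    have := hWdep v 0 1 0 c 0 (by simp)
    simpa using this
  have hWsymm : ∀ u v, W u v = W v u := by
    intro u v
    have := hWinv v u 0 1 1 0 (by simp)
    simpa using this
  have hWadd : ∀ u v (c : k), W u (v + c • u) = W u v := by
    intro u v c
    have := hWinv u v 1 0 c 1 (by simp)
    rw [← this]; simp [add_comm]
  -- step S
  have hd1 : ∀ z (a : Fin 6 → k), (P z * lin a ^ (p - 1)).totalDegree ≤ 5 * (p - 1) := by
    intro z a
    refine (totalDegree_mul _ _).trans ?_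
    have h1 := (totalDegree_pow (lin a) (p - 1))
    have h2 := Nat.mul_le_mul_left (p-1) (totalDegree_lin a)
    have := hdeg z
    omega
  have hd2 : ∀ z (a b : Fin 6 → k), (P z * lin a ^ (p - 1) * lin b ^ (p - 1)).totalDegree ≤ 6 * (p - 1) := by
    intro z a b
    refine (totalDegree_mul _ _).trans ?_
    have h1 := (totalDegree_pow (lin b) (p - 1))
    have h2 := Nat.mul_le_mul_left (p-1) (totalDegree_lin b)
    have := hd1 z a
    omega
  have s0 : ∀ z, ∑ v, W z v = 0 := fun z => sum_eval_pow_zero p t hk _ (by have := hdeg z; omega)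
  have s1 : ∀ z a, ∑ v, W z v * ((a ⬝ᵥ v) ^ (p - 1)) ^ e = 0 := by
    intro z a
    rw [← sum_eval_pow_zero p t hk (P z * lin a ^ (p - 1)) (by have := hd1 z a; omega)]
    refine Finset.sum_congr rfl fun v _ => ?_
    simp [W, eval_lin, mul_pow, he]
  have s2 : ∀ z a, ∑ v, W z v * ((Bvec z ⬝ᵥ v) ^ (p - 1)) ^ e * ((a ⬝ᵥ v) ^ (p - 1)) ^ e = ((a ⬝ᵥ z) ^ (p - 1) * T z) ^ e := by
    intro z a
    rw [← hco]
    have := sum_eval_pow p t hk 6 (P z * lin (Bvec z) ^ (p - 1) * lin a ^ (p - 1)) (hd2 z _ a)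
    rw [← he] at this
    rw [show (-1 : k) ^ 6 = 1 by norm_num, one_mul] at this
    rw [← this]
    refine Finset.sum_congr rfl fun v _ => ?_
    simp [W, eval_lin, mul_pow, he]
  have hC : ∀ y, ∑ z, W y z * (if B6 y z = 0 then 1 else 0) = 0 := by
    intro y
    simp only [indicator_pow p t hk]
    simp only [B6, mul_sub, mul_one, Finset.sum_sub_distrib]
    rw [s0, ← he, s1, sub_zero]
  have hmu : ∀ z : Fin 6 → k, z ≠ 0 → ∃ μ : Fin 6 → k, μ ⬝ᵥ z = 1 := by
    intro z hz
    obtain ⟨i, hi⟩ := Function.ne_iff.mp hz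
    refine ⟨Pi.single i (z i)⁻¹, ?_⟩
    rw [single_dotProduct, inv_mul_cancel₀ hi]
  have hS : ∀ z μ : Fin 6 → k, μ ⬝ᵥ z = 1 → T z ^ e = ∑ v, W z v * (if B6 z v = 0 then 1 else 0) * (if μ ⬝ᵥ v = 0 then 1 else 0) := by
    intro z μ h
    simp only [indicator_pow p t hk]
    simp only [B6, ← he]
    have : ∀ v, W z v * (1 - ((Bvec z ⬝ᵥ v) ^ (p - 1)) ^ e) * (1 - ((μ ⬝ᵥ v) ^ (p - 1)) ^ e) =
      W z v - W z v * ((Bvec z ⬝ᵥ v) ^ (p - 1)) ^ e - W z v * ((μ ⬝ᵥ v) ^ (p - 1)) ^ e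
        + W z v * ((Bvec z ⬝ᵥ v) ^ (p - 1)) ^ e * ((μ ⬝ᵥ v) ^ (p - 1)) ^ e := fun v => by ring
    simp only [this, Finset.sum_add_distrib, Finset.sum_sub_distrib, s0, s1, s2, h]
    simp
  have hA : ∀ z v, B6 z v = 0 → W z v * φ z = - ∑ c : k, W z v * φ (v + c • z) := by
    intro z v hB
    by_cases hli : LinearIndependent k ![z, v]
    · have := hφ.plane z v hli hB
      rw [plane_formula hφ.zero hφ.homog] at this
      rw [← Finset.mul_sum]
      linear_combination (-W z v) * this
    · have : W z v = 0 := by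
        by_cases hz : z = 0
        · rw [hz, hW0]
        · rw [LinearIndependent.pair_iff' hz] at hli
          push Not at hli
          obtain ⟨c, hc⟩ := hli
          rw [← hc, hWsm]
      simp [this]
  have hB : ∀ z, φ z * T z ^ e = - ∑ y, W z y * (if B6 z y = 0 then 1 else 0) * φ y := by
    intro z
    by_cases hz : z = 0
    · simp [hz, hφ.zero, hW0]
    obtain ⟨μ, hμ⟩ := hmu z hz
    rw [hS z μ hμ, Finset.mul_sum]
    have h1 : ∀ v, φ z * (W z v * (if B6 z v = 0 then 1 else 0) * (if μ ⬝ᵥ v = 0 then 1 else 0)) =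
      - ∑ c : k, (if B6 z v = 0 ∧ μ ⬝ᵥ v = 0 then W z v * φ (v + c • z) else 0) := by
      intro v
      by_cases h : B6 z v = 0
      · by_cases h' : μ ⬝ᵥ v = 0
        · simp only [h, h', and_self, if_true, mul_one]
          rw [← hA z v h, mul_comm]
        · simp [h, h']
      · simp [h]
    simp only [h1, Finset.sum_neg_distrib]
    congr 1
    rw [← Fintype.sum_prod_type']
    simp only [mul_ite, mul_one, mul_zero, ite_mul, zero_mul]
    rw [← Finset.sum_filter, ← Finset.sum_filter]
    have hBz : B6 z z = 0 := by rw [B6_eq]; ring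
    have hBl : ∀ v (c : k), B6 z (v + c • z) = B6 z v := by
      intro v c
      have : B6 z (v + c • z) = B6 z v + c * B6 z z := by
        simp [B6, dotProduct_add, dotProduct_smul]
      rw [this, hBz, mul_zero, add_zero]
    have hmul : ∀ v (c : k), μ ⬝ᵥ (v + c • z) = μ ⬝ᵥ v + c := by
      intro v c; simp [dotProduct_add, dotProduct_smul, hμ]
    refine Finset.sum_bij' (fun x _ => x.1 + x.2 • z) (fun y _ => (y + (-(μ ⬝ᵥ y)) • z, μ ⬝ᵥ y)) ?_ ?_ ?_ ?_ ?_
    · rintro ⟨v, c⟩ h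
      simp only [Finset.mem_filter, Finset.mem_univ, true_and] at h ⊢
      rw [hBl, h.1]
    · intro y h
      simp only [Finset.mem_filter, Finset.mem_univ, true_and] at h ⊢
      rw [hBl, hmul, h]; simp
    · rintro ⟨v, c⟩ h
      simp only [Finset.mem_filter, Finset.mem_univ, true_and] at h
      simp only [hmul, h.2]
      simp
    · intro y h
      simp
    · rintro ⟨v, c⟩ h
      simp only [hWadd]
  simp only [hB, Finset.sum_neg_distrib]
  rw [Finset.sum_comm, neg_eq_zero]
  refine Finset.sum_eq_zero fun y _ => ?_
  rw [← Finset.sum_mul]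
  have : ∑ z, W z y * (if B6 z y = 0 then 1 else 0) = ∑ z, W y z * (if B6 y z = 0 then 1 else 0) := by
    refine Finset.sum_congr rfl fun z _ => ?_
    rw [hWsymm, B6_symm z y]
    simp
  rw [this, hC, zero_mul]
end


section
variable {k : Type*} [Field k] [Fintype k] (p t : ℕ) [Fact p.Prime] [CharP k p]
open MvPolynomial

def goodSub : Submodule k ((Fin 6 → k) → k) where
  carrier := {T | Good p T}
  zero_mem' := ⟨fun _ => 0, by simp, by simp, by simp⟩
  add_mem' := by
    rintro T T' ⟨P, h1, h2, h3⟩ ⟨P', h1', h2', h3'⟩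
    refine ⟨fun z => P z + P' z, fun z => ?_, fun u v a b c d => ?_, fun z μ => ?_⟩
    · exact (totalDegree_add _ _).trans (max_le (h1 z) (h1' z))
    · simp only [map_add, h2, h2']; ring
    · simp only [add_mul, coeff_add, h3, h3', Pi.add_apply]; ring
  smul_mem' := by
    rintro x T ⟨P, h1, h2, h3⟩
    refine ⟨fun z => C x * P z, fun z => ?_, fun u v a b c d => ?_, fun z μ => ?_⟩
    · refine (totalDegree_mul _ _).trans ?_
      simpa using h1 z
    · simp only [map_mul, h2, eval_C]; ring
    · simp only [mul_assoc, coeff_C_mul, Pi.smul_apply, smul_eq_mul]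
      rw [← mul_assoc (P z), h3]; ring

lemma good_of_det (o0 o1 o2 o3 : (Fin 6 → k) → (Fin 6 → k)) (D : (Fin 6 → k) → k)
    (h0 : ∀ u v (a b c d : k), o0 (a • u + b • v) ⬝ᵥ (c • u + d • v) = (a * d - b * c) * (o0 u ⬝ᵥ v))
    (h1 : ∀ u v (a b c d : k), o1 (a • u + b • v) ⬝ᵥ (c • u + d • v) = (a * d - b * c) * (o1 u ⬝ᵥ v))
    (h2 : ∀ u v (a b c d : k), o2 (a • u + b • v) ⬝ᵥ (c • u + d • v) = (a * d - b * c) * (o2 u ⬝ᵥ v))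
    (h3 : ∀ u v (a b c d : k), o3 (a • u + b • v) ⬝ᵥ (c • u + d • v) = (a * d - b * c) * (o3 u ⬝ᵥ v))
    (hd : ∀ z μ, (Matrix.of ![o0 z, o1 z, o2 z, o3 z, Bvec z, μ]).det = (μ ⬝ᵥ z) * D z) :
    (fun z => D z ^ (p - 1)) ∈ goodSub (k := k) p := by
  have hl : ∀ a : Fin 6 → k, (lin a ^ (p - 1)).totalDegree ≤ p - 1 := by
    intro a
    have h1 := (totalDegree_pow (lin a) (p - 1))
    have h2 := Nat.mul_le_mul_left (p-1) (totalDegree_lin a)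
    omega
  refine ⟨fun z => lin (o0 z) ^ (p - 1) * lin (o1 z) ^ (p - 1) * lin (o2 z) ^ (p - 1) * lin (o3 z) ^ (p - 1),
    fun z => ?_, fun u v a b c d => ?_, fun z μ => ?_⟩
  · refine (totalDegree_mul _ _).trans ?_
    have e1 := totalDegree_mul (lin (o0 z) ^ (p - 1) * lin (o1 z) ^ (p - 1)) (lin (o2 z) ^ (p - 1))
    have e2 := totalDegree_mul (lin (o0 z) ^ (p - 1)) (lin (o1 z) ^ (p - 1))
    have := hl (o0 z)
    have := hl (o1 z)
    have := hl (o2 z)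
    have := hl (o3 z)
    omega
  · simp only [map_mul, map_pow, eval_lin, h0, h1, h2, h3]
    rw [mul_comm 4, pow_mul]; simp only [mul_pow]; ring
  · have := coeff_prod_lin p (Matrix.of ![o0 z, o1 z, o2 z, o3 z, Bvec z, μ])
    rw [hd, mul_pow] at this
    rw [← this, Fin.prod_univ_six]
    rfl

lemma neg_pow_pred (hp : Odd p) (x : k) : (-x) ^ (p - 1) = x ^ (p - 1) := by
  apply Even.neg_pow
  exact Nat.Odd.sub_odd hp odd_one

lemma fam1 (hp : Odd p) (s t : k) :
    (fun z : Fin 6 → k => (z 0 * z 1) ^ (p - 1) * (z 2 * z 4 + s * (z 2 * z 3 + z 4 * z 5) + t * (z 3 * z 5)) ^ (p - 1))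
      ∈ goodSub (k := k) p := by
  have := good_of_det p (fun z : Fin 6 → k => ![-z 1, z 0,0,0,0,0]) (fun z => ![-(z 4+s * z 3),0,0,s *z 0, z 0,0])
    (fun z => ![0,-z 5,0,0,0,z 1])
    (fun z => ![0,0,z 4 + s * z 3, -s * (z 2 + s * z 5) + (t - s^2) * z 5, -(z 2 + s * z 5), s * (z 4 + s * z 3) - (t - s^2) * z 3])
    (fun z => -(z 0 * z 1 * (z 2 * z 4 + s * (z 2 * z 3 + z 4 * z 5) + t * (z 3 * z 5))))
    (by intros; simp [dotProduct, Fin.sum_univ_six]; ring) (by intros; simp [dotProduct, Fin.sum_univ_six]; ring)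
    (by intros; simp [dotProduct, Fin.sum_univ_six]; ring) (by intros; simp [dotProduct, Fin.sum_univ_six]; ring)
    (by intro z μ; simp [Matrix.det_succ_row_zero, Fin.sum_univ_succ, Bvec, dotProduct, Fin.succAbove]; ring)
  simpa only [neg_pow_pred p hp, mul_pow] using this

lemma fam2 (hp : Odd p) (s t : k) :
    (fun z : Fin 6 → k => (z 2 * z 3) ^ (p - 1) * (z 0 * z 4 + s * (z 0 * z 1 + z 4 * z 5) + t * (z 1 * z 5)) ^ (p - 1))
      ∈ goodSub (k := k) p := by
  have := good_of_det p (fun z : Fin 6 → k => ![0,0,-z 3, z 2,0,0]) (fun z => ![0,s *z 2,-(z 4+s * z 1),0, z 2,0])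
    (fun z => ![0,0,0,-z 5,0,z 3])
    (fun z => ![z 4 + s * z 1, -s * (z 0 + s * z 5) + (t - s^2) * z 5, 0,0,-(z 0 + s * z 5), s * (z 4 + s * z 1) - (t - s^2) * z 1])
    (fun z => -(z 2 * z 3 * (z 0 * z 4 + s * (z 0 * z 1 + z 4 * z 5) + t * (z 1 * z 5))))
    (by intros; simp [dotProduct, Fin.sum_univ_six]; ring) (by intros; simp [dotProduct, Fin.sum_univ_six]; ring)
    (by intros; simp [dotProduct, Fin.sum_univ_six]; ring) (by intros; simp [dotProduct, Fin.sum_univ_six]; ring)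
    (by intro z μ; simp [Matrix.det_succ_row_zero, Fin.sum_univ_succ, Bvec, dotProduct, Fin.succAbove]; ring)
  simpa only [neg_pow_pred p hp, mul_pow] using this

lemma fam3 (hp : Odd p) (s t : k) :
    (fun z : Fin 6 → k => (z 4 * z 5) ^ (p - 1) * (z 2 * z 0 + s * (z 2 * z 3 + z 0 * z 1) + t * (z 3 * z 1)) ^ (p - 1))
      ∈ goodSub (k := k) p := by
  have := good_of_det p (fun z : Fin 6 → k => ![0,0,0,0,-z 5, z 4]) (fun z => ![z 4,0,0,s *z 4,-(z 0+s * z 3),0])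
    (fun z => ![0,z 5,0,0,0,-z 1])
    (fun z => ![-(z 2 + s * z 1), s * (z 0 + s * z 3) - (t - s^2) * z 3, z 0 + s * z 3, -s * (z 2 + s * z 1) + (t - s^2) * z 1, 0,0])
    (fun z => -(z 4 * z 5 * (z 2 * z 0 + s * (z 2 * z 3 + z 0 * z 1) + t * (z 3 * z 1))))
    (by intros; simp [dotProduct, Fin.sum_univ_six]; ring) (by intros; simp [dotProduct, Fin.sum_univ_six]; ring)
    (by intros; simp [dotProduct, Fin.sum_univ_six]; ring) (by intros; simp [dotProduct, Fin.sum_univ_six]; ring)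
    (by intro z μ; simp [Matrix.det_succ_row_zero, Fin.sum_univ_succ, Bvec, dotProduct, Fin.succAbove]; ring)
  simpa only [neg_pow_pred p hp, mul_pow] using this

lemma coeff_extract {M : Type*} [AddCommGroup M] [Module k M] (N : Submodule k M) (n : ℕ)
    (hn : n ≤ Fintype.card k) (c : ℕ → M) (h : ∀ s : k, ∑ j ∈ Finset.range n, s ^ j • c j ∈ N) :
    ∀ j < n, c j ∈ N := by
  intro j hj
  rw [← Submodule.Quotient.mk_eq_zero N]
  rw [← Module.forall_dual_apply_eq_zero_iff k]
  intro f
  let P : Polynomial k := ∑ j ∈ Finset.range n, Polynomial.C (f (N.mkQ (c j))) * Polynomial.X ^ j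
  have hP : P = 0 := by
    refine Polynomial.eq_zero_of_natDegree_lt_card_of_eval_eq_zero' P Finset.univ ?_ ?_
    · intro s _
      have := (Submodule.Quotient.mk_eq_zero N).mpr (h s)
      have h2 : f (N.mkQ (∑ j ∈ Finset.range n, s ^ j • c j)) = 0 := by
        rw [Submodule.mkQ_apply, this, map_zero]
      simp only [map_sum, map_smul, smul_eq_mul] at h2
      rw [← h2]
      simp only [P, Polynomial.eval_finsetSum, Polynomial.eval_mul, Polynomial.eval_C, Polynomial.eval_pow,
        Polynomial.eval_X]
      exact Finset.sum_congr rfl fun i _ => mul_comm _ _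
    · have : P.degree < n := by
        rw [← Polynomial.mem_degreeLT]
        refine Submodule.sum_mem _ fun i hi => ?_
        rw [Polynomial.mem_degreeLT]
        refine lt_of_le_of_lt (Polynomial.degree_C_mul_X_pow_le _ _) ?_
        exact_mod_cast Finset.mem_range.mp hi
      rw [Finset.card_univ]
      refine lt_of_lt_of_le ?_ hn
      by_cases hP0 : P = 0
      · rw [hP0]; simp; omega
      · exact (Polynomial.natDegree_lt_iff_degree_lt hP0).mpr this
  have h3 : P.coeff j = f (N.mkQ (c j)) := by
    simp [P, Polynomial.finsetSum_coeff, Polynomial.coeff_X_pow, hj]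
  rw [hP] at h3
  simpa using h3.symm

lemma choose_ne_zero (n j : ℕ) (hn : n < p) (hj : j ≤ n) : ((n.choose j : ℕ) : k) ≠ 0 := by
  intro h
  have h1 := (CharP.cast_eq_zero_iff k p _).mp h
  have h2 : p ∣ n.factorial := by
    rw [← Nat.choose_mul_factorial_mul_factorial hj, mul_assoc]
    exact h1.mul_right _
  have := ((Fact.out : p.Prime).dvd_factorial).mp h2
  omega

lemma binom_extract {R : Type*} [CommRing R] [Algebra k R] (N : Submodule k R) (n : ℕ) (hn : n < p)
    (hc : n < Fintype.card k) (c a b : R) (h : ∀ s : k, c * (a + s • b) ^ n ∈ N) :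
    ∀ j ≤ n, c * (b ^ j * a ^ (n - j)) ∈ N := by
  intro j hj
  have := coeff_extract N (n + 1) hc (fun j => ((n.choose j : ℕ) : k) • (c * (b ^ j * a ^ (n - j)))) (by
    intro s
    convert h s using 1
    rw [add_comm a, add_pow, Finset.mul_sum]
    refine Finset.sum_congr rfl fun i _ => ?_
    simp only [Algebra.smul_def, map_natCast, map_pow, mul_pow]
    ring) j (by omega)
  exact (N.smul_mem_iff (choose_ne_zero p n j hn hj)).mp this

lemma power_sum_mem {R : Type*} [CommRing R] (N : AddSubgroup R) (u v : R) :
    ∀ (n : ℕ) (c : R), (∀ i j, 2 * i + j = n → c * ((u * v) ^ i * (u + v) ^ j) ∈ N) →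
      c * (u ^ n + v ^ n) ∈ N := by
  intro n
  induction n using Nat.strong_induction_on with
  | _ n ih =>
    intro c h
    match n, ih, h with
    | 0, ih, h =>
      have := h 0 0 rfl
      have h2 := N.add_mem this this
      convert h2 using 1; ring
    | 1, ih, h =>
      have := h 0 1 rfl
      convert this using 1; ring
    | n + 2, ih, h =>
      have h1 := ih (n + 1) (by omega) (c * (u + v)) (by
        intro i j hij
        have := h i (j + 1) (by omega)
        convert this using 1; ring)
      have h2 := ih n (by omega) (c * (u * v)) (by
        intro i j hij
        have := h (i + 1) j (by omega)
        convert this using 1; ring)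
      have := N.sub_mem h1 h2
      convert this using 1; ring

lemma fam_extract {R : Type*} [CommRing R] [Algebra k R] (N : Submodule k R)
    (hc : p ≤ Fintype.card k) (w x2 y2 x3 y3 : R)
    (h : ∀ s t : k, w * (x2 * x3 + s • (x2 * y2 + x3 * y3) + t • (y2 * y3)) ^ (p - 1) ∈ N) :
    w * ((x2 * y2) ^ (p - 1) + (x3 * y3) ^ (p - 1)) ∈ N := by
  have hp2 : 2 ≤ p := (Fact.out : p.Prime).two_le
  apply power_sum_mem N.toAddSubgroup
  intro i j hij
  have h1 : ∀ t : k, (w * (x2 * y2 + x3 * y3) ^ j) * (x2 * x3 + t • (y2 * y3)) ^ (p - 1 - j) ∈ N := by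
    intro t
    have := binom_extract p N (p - 1) (by omega) (by omega) w (x2 * x3 + t • (y2 * y3)) (x2 * y2 + x3 * y3)
      (fun s => by convert h s t using 3; ring) j (by omega)
    rwa [← mul_assoc] at this
  have h2 := binom_extract p N (p - 1 - j) (by omega) (by omega) _ _ _ h1 i (by omega)
  rw [show p - 1 - j - i = i by omega] at h2
  show _ ∈ N
  convert h2 using 1
  simp only [mul_pow]; ring

lemma good_final (hp : Odd p) (hc : p ≤ Fintype.card k) :
    Good p (fun z : Fin 6 → k => (z 0 * z 1 * (z 2 * z 3)) ^ (p - 1)) := by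
  have hp2 : 2 ≤ p := (Fact.out : p.Prime).two_le
  let x : Fin 6 → ((Fin 6 → k) → k) := fun i z => z i
  have f1 := fam_extract p (goodSub (k := k) p) hc ((x 0 * x 1) ^ (p - 1)) (x 2) (x 3) (x 4) (x 5)
    (fun s t => fam1 p hp s t)
  have f2 := fam_extract p (goodSub (k := k) p) hc ((x 2 * x 3) ^ (p - 1)) (x 0) (x 1) (x 4) (x 5)
    (fun s t => fam2 p hp s t)
  have f3 := fam_extract p (goodSub (k := k) p) hc ((x 4 * x 5) ^ (p - 1)) (x 2) (x 3) (x 0) (x 1)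
    (fun s t => fam3 p hp s t)
  have h := (goodSub (k := k) p).sub_mem ((goodSub (k := k) p).add_mem f1 f2) f3
  have h2 : (2 : k) • ((x 0 * x 1 * (x 2 * x 3)) ^ (p - 1)) ∈ goodSub (k := k) p := by
    convert h using 1
    rw [two_smul, mul_pow (x 0 * x 1) (x 2 * x 3)]; ring
  have h20 : (2 : k) ≠ 0 := by
    intro h
    have h1 := (CharP.cast_eq_zero_iff k p 2).mp (by exact_mod_cast h)
    have := Nat.le_of_dvd (by norm_num) h1
    have : p = 2 := by omega
    subst this
    exact absurd hp (by decide)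
  exact ((goodSub (k := k) p).smul_mem_iff h20).mp h2
end


section
variable {k : Type*} [Field k] [Fintype k] (p t : ℕ) [Fact p.Prime] [CharP k p]

lemma sum_vecCons (n : ℕ) (f : (Fin (n+1) → k) → k) :
    ∑ z, f z = ∑ a : k, ∑ v : Fin n → k, f (Matrix.vecCons a v) := by
  rw [← (Fin.consEquiv (fun _ => k)).sum_comp, Fintype.sum_prod_type]
  rfl

lemma sum_six (f : (Fin 6 → k) → k) :
    ∑ z, f z = ∑ a, ∑ b, ∑ c, ∑ d, ∑ x, ∑ y, f ![a, b, c, d, x, y] := by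
  simp only [sum_vecCons]
  simp
  rfl

lemma adm_line {φ : (Fin 6 → k) → k} (hφ : Adm φ) (u w : Fin 6 → k) (h : B6 w u = 0) :
    ∑ c : k, φ (u + c • w) = - φ w := by
  have hz : ∑ x : k, ∑ y : k, φ (x • w + y • u) = 0 := by
    by_cases hli : LinearIndependent k ![w, u]
    · exact hφ.plane w u hli h
    · by_cases hw : w = 0
      · simp [hw, FiniteField.cast_card_eq_zero k]
      · rw [LinearIndependent.pair_iff' hw] at hli
        push Not at hli
        obtain ⟨c, hc⟩ := hli
        rw [Finset.sum_comm]
        have : ∀ y : k, ∑ x : k, φ (x • w + y • u) = ∑ x : k, φ (x • w) := by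
          intro y
          refine Fintype.sum_equiv (Equiv.addRight (y * c)) _ _ fun x => ?_
          simp [← hc, add_smul, smul_smul]
        simp [this, FiniteField.cast_card_eq_zero k]
  rw [plane_formula hφ.zero hφ.homog] at hz
  linear_combination -hz

lemma adm_two {φ : (Fin 6 → k) → k} (hφ : Adm φ) (u e f : Fin 6 → k) (he : B6 e u = 0) (hf : B6 f u = 0) :
    ∑ a : k, ∑ b : k, φ (u + a • e + b • f) = ∑ a : k, ∑ b : k, φ (a • e + b • f) := by
  have h1 : ∑ a : k, ∑ b : k, ∑ c : k, φ (u + c • (a • e + b • f)) = - ∑ a : k, ∑ b : k, φ (a • e + b • f) := by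
    simp only [← Finset.sum_neg_distrib]
    refine Finset.sum_congr rfl fun a _ => Finset.sum_congr rfl fun b _ => ?_
    apply adm_line hφ
    have : B6 (a • e + b • f) u = a * B6 e u + b * B6 f u := by
      simp only [B6_eq, Pi.add_apply, Pi.smul_apply, smul_eq_mul]; ring
    rw [this, he, hf]; ring
  have h2 : ∑ a : k, ∑ b : k, ∑ c : k, φ (u + c • (a • e + b • f)) = ∑ c : k, ∑ a : k, ∑ b : k, φ (u + c • (a • e + b • f)) := by
    rw [Finset.sum_congr rfl fun a _ => Finset.sum_comm]
    rw [Finset.sum_comm]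
  have h3 : ∀ c : k, ∑ a : k, ∑ b : k, φ (u + c • (a • e + b • f)) =
      if c = 0 then 0 else ∑ a : k, ∑ b : k, φ (u + a • e + b • f) := by
    intro c
    split_ifs with h
    · simp [h, FiniteField.cast_card_eq_zero k]
    · refine Fintype.sum_equiv (Equiv.mulLeft₀ c h) _ _ fun a => ?_
      refine Fintype.sum_equiv (Equiv.mulLeft₀ c h) _ _ fun b => ?_
      congr 1
      simp [smul_smul, add_assoc]
  rw [h2] at h1
  simp only [h3, sum_units_const] at h1
  exact neg_injective h1

lemma incl_excl (g : k → k → k) (h : ∑ a, ∑ b, g a b = 0) (h1 : ∑ a, g a 0 = 0) (h2 : ∑ b, g 0 b = 0) :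
    ∑ a, ∑ b, (if a * b = 0 then 0 else g a b) = g 0 0 := by
  have : ∀ a b, (if a * b = 0 then 0 else g a b) = g a b - (if b = 0 then g a b else 0) - (if a = 0 then g a b else 0)
     + (if b = 0 then (if a = 0 then g a b else 0) else 0) := by
    intro a b
    by_cases ha : a = 0 <;> by_cases hb : b = 0 <;> simp [ha, hb]
  simp only [this, Finset.sum_add_distrib, Finset.sum_sub_distrib, h]
  rw [Finset.sum_comm (f := fun a b => if a = 0 then g a b else 0)]
  simp [h1, h2]

/-- the core theorem in coordinates -/
lemma core (hodd : Odd p) (hk : Fintype.card k = p ^ t) {φ : (Fin 6 → k) → k} (hφ : Adm φ) :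
    ∑ x : k, ∑ y : k, φ ![0, 0, 0, 0, x, y] = 0 := by
  have hp2 : 2 ≤ p := (Fact.out : p.Prime).two_le
  have hc : p ≤ Fintype.card k := by
    have h3 : 1 < Fintype.card k := Fintype.one_lt_card
    have ht : t ≠ 0 := by rintro rfl; simp [hk] at h3
    rw [hk]; exact Nat.le_self_pow ht p
  have h0 := good_sum p t hk hφ (good_final p hodd hc)
  let G : k → k → k → k → k := fun a b c d => ∑ x : k, ∑ y : k, φ ![a, b, c, d, x, y]
  have h1 : ∑ a, ∑ b, ∑ c, ∑ d, (if c * d = 0 then 0 else if a * b = 0 then 0 else G a b c d) = 0 := by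
    refine Eq.trans ?_ h0
    rw [sum_six]
    refine Finset.sum_congr rfl fun a _ => Finset.sum_congr rfl fun b _ => 
      Finset.sum_congr rfl fun c _ => Finset.sum_congr rfl fun d _ => ?_
    have := indicator_pow p t hk (a * b * (c * d))
    have h2 : ∀ x y, φ ![a, b, c, d, x, y] * ((![a, b, c, d, x, y] 0 * ![a, b, c, d, x, y] 1 * (![a, b, c, d, x, y] 2 * ![a, b, c, d, x, y] 3)) ^ (p - 1)) ^ (∑ l : Fin t, p ^ (l : ℕ))
       = φ ![a, b, c, d, x, y] * (1 - if a * b * (c * d) = 0 then 1 else 0) := by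
      intro x y
      rw [this]
      simp
    simp only [h2]
    by_cases hab : a * b = 0 <;> by_cases hcd : c * d = 0 <;> simp [hab, hcd, G]
  have qz : ∀ r : k, ∑ x : k, ∑ y : k, r = 0 := by
    intro r; simp [FiniteField.cast_card_eq_zero k]
  have l0 : ∀ c d, ∑ a, G a 0 c d = 0 := by
    intro c d
    simp only [G]
    rw [Finset.sum_comm]
    rw [← qz (- φ (Pi.single 0 1))]
    refine Finset.sum_congr rfl fun x _ => ?_
    rw [Finset.sum_comm]
    refine Finset.sum_congr rfl fun y _ => ?_
    rw [← adm_line hφ ![0, 0, c, d, x, y] (Pi.single 0 1) (by simp [B6_eq])]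
    refine Finset.sum_congr rfl fun a _ => ?_
    congr 1
    ext i; fin_cases i <;> simp
  have l1 : ∀ c d, ∑ b, G 0 b c d = 0 := by
    intro c d
    simp only [G]
    rw [Finset.sum_comm]
    rw [← qz (- φ (Pi.single 1 1))]
    refine Finset.sum_congr rfl fun x _ => ?_
    rw [Finset.sum_comm]
    refine Finset.sum_congr rfl fun y _ => ?_
    rw [← adm_line hφ ![0, 0, c, d, x, y] (Pi.single 1 1) (by simp [B6_eq])]
    refine Finset.sum_congr rfl fun a _ => ?_
    congr 1
    ext i; fin_cases i <;> simp
  have l2 : ∑ c, G 0 0 c 0 = 0 := by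
    simp only [G]
    rw [Finset.sum_comm]
    rw [← qz (- φ (Pi.single 2 1))]
    refine Finset.sum_congr rfl fun x _ => ?_
    rw [Finset.sum_comm]
    refine Finset.sum_congr rfl fun y _ => ?_
    rw [← adm_line hφ ![0, 0, 0, 0, x, y] (Pi.single 2 1) (by simp [B6_eq])]
    refine Finset.sum_congr rfl fun a _ => ?_
    congr 1
    ext i; fin_cases i <;> simp
  have l3 : ∑ d, G 0 0 0 d = 0 := by
    simp only [G]
    rw [Finset.sum_comm]
    rw [← qz (- φ (Pi.single 3 1))]
    refine Finset.sum_congr rfl fun x _ => ?_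
    rw [Finset.sum_comm]
    refine Finset.sum_congr rfl fun y _ => ?_
    rw [← adm_line hφ ![0, 0, 0, 0, x, y] (Pi.single 3 1) (by simp [B6_eq])]
    refine Finset.sum_congr rfl fun a _ => ?_
    congr 1
    ext i; fin_cases i <;> simp
  have m0 : ∀ c d, ∑ a, ∑ b, G a b c d = 0 := by
    intro c d
    have e1 : ∑ a, ∑ b, G a b c d = ∑ x, ∑ y, ∑ a, ∑ b, φ ![a, b, c, d, x, y] := by
      simp only [G]
      rw [Finset.sum_congr rfl fun a _ => Finset.sum_comm]
      rw [Finset.sum_comm]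
      refine Finset.sum_congr rfl fun x _ => ?_
      rw [Finset.sum_congr rfl fun a _ => Finset.sum_comm]
      rw [Finset.sum_comm]
    rw [e1, ← qz (∑ a : k, ∑ b : k, φ (a • (Pi.single 0 1) + b • (Pi.single 1 1)))]
    refine Finset.sum_congr rfl fun x _ => Finset.sum_congr rfl fun y _ => ?_
    rw [← adm_two hφ ![0, 0, c, d, x, y] (Pi.single 0 1) (Pi.single 1 1) (by simp [B6_eq]) (by simp [B6_eq])]
    refine Finset.sum_congr rfl fun a _ => Finset.sum_congr rfl fun b _ => ?_
    congr 1
    ext i; fin_cases i <;> simp [Matrix.vecHead, Matrix.vecTail]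
  have m1 : ∑ c, ∑ d, G 0 0 c d = 0 := by
    have e1 : ∑ c, ∑ d, G 0 0 c d = ∑ x, ∑ y, ∑ c, ∑ d, φ ![0, 0, c, d, x, y] := by
      simp only [G]
      rw [Finset.sum_congr rfl fun a _ => Finset.sum_comm]
      rw [Finset.sum_comm]
      refine Finset.sum_congr rfl fun x _ => ?_
      rw [Finset.sum_congr rfl fun a _ => Finset.sum_comm]
      rw [Finset.sum_comm]
    rw [e1, ← qz (∑ a : k, ∑ b : k, φ (a • (Pi.single 2 1) + b • (Pi.single 3 1)))]
    refine Finset.sum_congr rfl fun x _ => Finset.sum_congr rfl fun y _ => ?_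
    rw [← adm_two hφ ![0, 0, 0, 0, x, y] (Pi.single 2 1) (Pi.single 3 1) (by simp [B6_eq]) (by simp [B6_eq])]
    refine Finset.sum_congr rfl fun a _ => Finset.sum_congr rfl fun b _ => ?_
    congr 1
    ext i; fin_cases i <;> simp [Matrix.vecHead, Matrix.vecTail]
  have h3 : ∑ a, ∑ b, ∑ c, ∑ d, (if c * d = 0 then 0 else if a * b = 0 then 0 else G a b c d) =
      ∑ c, ∑ d, ∑ a, ∑ b, (if c * d = 0 then 0 else if a * b = 0 then 0 else G a b c d) := by
    rw [Finset.sum_congr rfl fun a _ => Finset.sum_comm]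
    rw [Finset.sum_comm]
    refine Finset.sum_congr rfl fun c _ => ?_
    rw [Finset.sum_congr rfl fun a _ => Finset.sum_comm]
    rw [Finset.sum_comm]
  have h4 : ∀ c d, ∑ a, ∑ b, (if c * d = 0 then 0 else if a * b = 0 then 0 else G a b c d) =
      if c * d = 0 then 0 else G 0 0 c d := by
    intro c d
    split_ifs with h
    · simp
    · exact incl_excl (fun a b => G a b c d) (m0 c d) (l0 c d) (l1 c d)
  rw [h3] at h1
  simp only [h4] at h1
  rw [incl_excl (fun c d => G 0 0 c d) m1 l2 l3] at h1
  exact h1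
end




section
variable {k : Type*} [Field k] [Fintype k] {V : Type*} [AddCommGroup V] [Module k V] [FiniteDimensional k V]

lemma count_line (x0 y0 : k) (h : ¬ (x0 = 0 ∧ y0 = 0)) :
    ∑ w : k × k, (if ∃ d : k, d ≠ 0 ∧ w = (d * x0, d * y0) then (1:k) else 0) = -1 := by
  rw [Finset.sum_boole]
  have : (Finset.univ.filter fun w : k × k => ∃ d : k, d ≠ 0 ∧ w = (d * x0, d * y0)) =
      (Finset.univ.erase (0:k)).image (fun d => (d * x0, d * y0)) := by
    ext w
    simp only [Finset.mem_filter, Finset.mem_univ, true_and, Finset.mem_image, Finset.mem_erase, and_true]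
    constructor
    · rintro ⟨d, h1, h2⟩; exact ⟨d, h1, h2.symm⟩
    · rintro ⟨d, h1, h2⟩; exact ⟨d, h1, h2.symm⟩
  rw [this, Finset.card_image_of_injective, Finset.card_erase_of_mem (Finset.mem_univ _), Finset.card_univ]
  · rw [Nat.cast_sub Fintype.card_pos, FiniteField.cast_card_eq_zero k]; simp
  · intro d d' hd
    simp only [Prod.mk.injEq] at hd
    by_cases hx : x0 = 0
    · have hy : y0 ≠ 0 := fun hy => h ⟨hx, hy⟩
      exact mul_right_cancel₀ hy hd.2
    · exact mul_right_cancel₀ hx hd.1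

lemma chi_plane (a b : V) (U' : Submodule k V) (h : ∀ x y : k, x • a + y • b ∈ U' → x = 0 ∧ y = 0) :
    ∑ w : k × k, (if w = 0 then 0 else chiFun (Submodule.span k {w.1 • a + w.2 • b} ⊔ U')) =
      - chiFun (Submodule.span k {a, b} ⊔ U') := by
  funext ⟨Z, hZ⟩
  obtain ⟨z, hz0, hz⟩ := finrank_eq_one_iff'.mp hZ
  have hle : ∀ W : Submodule k V, Z ≤ W ↔ (z : V) ∈ W := by
    intro W
    constructor
    · intro h; exact h z.2
    · intro h y hy
      obtain ⟨c, hc⟩ := hz ⟨y, hy⟩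
      have : y = c • (z : V) := by
        have := congrArg Subtype.val hc
        simpa using this.symm
      rw [this]; exact W.smul_mem _ h
  rw [Finset.sum_apply]
  have h1 : ∀ w : k × k, (if w = 0 then (0 : {Z : Submodule k V // Module.finrank k Z = 1} → k) else chiFun (Submodule.span k {w.1 • a + w.2 • b} ⊔ U')) ⟨Z, hZ⟩
     = if w = 0 then 0 else if (z : V) ∈ Submodule.span k {w.1 • a + w.2 • b} ⊔ U' then 1 else 0 := by
    intro w
    split_ifs with h1 h2
    · rfl
    · simp [chiFun, hle, h2]
    · simp_all [chiFun, hle]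
  simp only [h1, Pi.neg_apply]
  have h2 : chiFun (Submodule.span k {a, b} ⊔ U') ⟨Z, hZ⟩ = if (z : V) ∈ Submodule.span k {a, b} ⊔ U' then 1 else 0 := by
    simp [chiFun, hle]
  rw [h2]
  by_cases hzU : (z : V) ∈ U'
  · have hm : ∀ W : Submodule k V, (z : V) ∈ W ⊔ U' := fun W => Submodule.mem_sup_right hzU
    simp only [hm, if_true]
    have : ∀ w : k × k, (if w = 0 then (0:k) else 1) = 1 - if w = 0 then 1 else 0 := by
      intro w; split_ifs <;> simp
    simp only [this, Finset.sum_sub_distrib]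
    simp [Fintype.card_prod, FiniteField.cast_card_eq_zero k]
  by_cases hzS : (z : V) ∈ Submodule.span k {a, b} ⊔ U'
  · rw [if_pos hzS]
    obtain ⟨s, hs, u', hu', hsu⟩ := Submodule.mem_sup.mp hzS
    obtain ⟨x0, y0, hxy⟩ := Submodule.mem_span_pair.mp hs
    have hne : ¬ (x0 = 0 ∧ y0 = 0) := by
      rintro ⟨rfl, rfl⟩
      apply hzU
      rw [← hsu, ← hxy]; simpa using hu'
    rw [← count_line x0 y0 hne]
    refine Finset.sum_congr rfl fun w _ => ?_
    obtain ⟨x, y⟩ := w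
    have key : ((z : V) ∈ Submodule.span k {x • a + y • b} ⊔ U' ↔ ∃ c : k, x0 = c * x ∧ y0 = c * y) := by
      constructor
      · intro hmem
        obtain ⟨s', hs', u'', hu'', hsu'⟩ := Submodule.mem_sup.mp hmem
        obtain ⟨c, rfl⟩ := Submodule.mem_span_singleton.mp hs'
        refine ⟨c, ?_⟩
        have := h (x0 - c * x) (y0 - c * y) (by
          have e : (x0 - c * x) • a + (y0 - c * y) • b = u'' - u' := by
            have e1 : x0 • a + y0 • b + u' = c • (x • a + y • b) + u'' := by rw [hxy, hsu, hsu']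
            have e2 : u'' - u' = x0 • a + y0 • b - c • (x • a + y • b) := by
              rw [sub_eq_sub_iff_add_eq_add, add_comm u'', ← e1]
            rw [e2]; module
          rw [e]; exact U'.sub_mem hu'' hu')
        exact ⟨sub_eq_zero.mp this.1, sub_eq_zero.mp this.2⟩
      · rintro ⟨c, h1, h2⟩
        refine Submodule.mem_sup.mpr ⟨c • (x • a + y • b), Submodule.smul_mem _ _ (Submodule.mem_span_singleton_self _), u', hu', ?_⟩
        rw [← hsu, ← hxy, h1, h2]; module
    by_cases hw : ((x, y) : k × k) = 0
    · rw [if_pos hw, if_neg]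
      rintro ⟨d, hd, hd2⟩
      simp only [Prod.mk.injEq, Prod.mk_eq_zero] at hd2 hw
      apply hne
      rw [hw.1, hw.2] at hd2
      exact ⟨by simpa [hd] using hd2.1.symm, by simpa [hd] using hd2.2.symm⟩
    · rw [if_neg hw]
      congr 1
      simp only [key, eq_iff_iff]
      constructor
      · rintro ⟨c, h1, h2⟩
        have hc : c ≠ 0 := by
          rintro rfl
          apply hne; simp [h1, h2]
        refine ⟨c⁻¹, inv_ne_zero hc, ?_⟩
        rw [h1, h2, inv_mul_cancel_left₀ hc, inv_mul_cancel_left₀ hc]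
      · rintro ⟨d, hd, hd2⟩
        simp only [Prod.mk.injEq] at hd2
        refine ⟨d⁻¹, ?_, ?_⟩
        · rw [hd2.1, inv_mul_cancel_left₀ hd]
        · rw [hd2.2, inv_mul_cancel_left₀ hd]
  · rw [if_neg hzS, neg_zero]
    refine Finset.sum_eq_zero fun w _ => ?_
    rw [if_neg (c := (z : V) ∈ Submodule.span k {w.1 • a + w.2 • b} ⊔ U')]
    · simp
    · intro hmem
      apply hzS
      refine (sup_le_sup_right ?_ U') hmem
      rw [Submodule.span_singleton_le_iff_mem]
      exact Submodule.mem_span_pair.mpr ⟨w.1, w.2, rfl⟩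

lemma finrank_plane (a b : V) (U' : Submodule k V) (h : ∀ x y : k, x • a + y • b ∈ U' → x = 0 ∧ y = 0) :
    Module.finrank k ↥(Submodule.span k {a, b} ⊔ U') = 2 + Module.finrank k U' := by
  have h1 := Submodule.finrank_sup_add_finrank_inf_eq (Submodule.span k {a, b}) U'
  have h2 : Submodule.span k {a, b} ⊓ U' = ⊥ := by
    rw [eq_bot_iff]
    rintro x ⟨hx, hxU⟩
    obtain ⟨s, t, rfl⟩ := Submodule.mem_span_pair.mp hx
    obtain ⟨rfl, rfl⟩ := h s t hxU
    simp
  have hli : LinearIndependent k ![a, b] := by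
    rw [LinearIndependent.pair_iff]
    intro s t hst
    exact h s t (by rw [hst]; exact U'.zero_mem)
  have h3 := finrank_span_eq_card hli
  rw [show Set.range ![a, b] = {a, b} by simp [Matrix.range_cons, Set.pair_comm]] at h3
  rw [h2, h3] at h1
  simpa using h1

lemma finrank_inf_ker (A : Submodule k V) (f : V →ₗ[k] k) :
    Module.finrank k A ≤ Module.finrank k ↥(A ⊓ LinearMap.ker f) + 1 := by
  have h1 := Submodule.finrank_sup_add_finrank_inf_eq A (LinearMap.ker f)
  have h2 := LinearMap.finrank_range_add_finrank_ker f
  have h3 : Module.finrank k (LinearMap.range f) ≤ 1 := by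
    simpa using Submodule.finrank_le (LinearMap.range f)
  have h4 := Submodule.finrank_le (A ⊔ LinearMap.ker f)
  omega

variable (B : V →ₗ[k] V →ₗ[k] k)

lemma alt_symm (halt : ∀ v, B v v = 0) (u v : V) : B u v = - B v u := by
  have := halt (u + v)
  simp only [map_add, LinearMap.add_apply, halt, zero_add, add_zero] at this
  exact eq_neg_of_add_eq_zero_right this

lemma exists_hyp (A U' : Submodule k V) (hA : ∀ a ∈ A, (∀ b ∈ A, B a b = 0) → a ∈ U')
    (hlt : Module.finrank k U' < Module.finrank k A) : ∃ a ∈ A, ∃ b ∈ A, B a b = 1 := by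
  have : ¬ A ≤ U' := fun h => absurd (Submodule.finrank_mono h) (by omega)
  obtain ⟨a, ha, haU⟩ := SetLike.not_le_iff_exists.mp this
  have : ∃ b ∈ A, B a b ≠ 0 := by
    by_contra hcon
    push Not at hcon
    exact haU (hA a ha hcon)
  obtain ⟨b, hb, hne⟩ := this
  refine ⟨a, ha, (B a b)⁻¹ • b, A.smul_mem _ hb, ?_⟩
  rw [map_smul, smul_eq_mul, inv_mul_cancel₀ hne]

lemma step_hyp (halt : ∀ v, B v v = 0) (A U' : Submodule k V) (hA : ∀ a ∈ A, (∀ b ∈ A, B a b = 0) → a ∈ U')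
    (a b : V) (ha : a ∈ A) (hb : b ∈ A) (hab : B a b = 1) :
    ∀ x ∈ A ⊓ LinearMap.ker (B a) ⊓ LinearMap.ker (B b),
      (∀ y ∈ A ⊓ LinearMap.ker (B a) ⊓ LinearMap.ker (B b), B x y = 0) → x ∈ U' := by
  rintro x ⟨⟨hx, hxa⟩, hxb⟩ hxy
  rw [SetLike.mem_coe, LinearMap.mem_ker] at hxa hxb
  refine hA x hx fun y hy => ?_
  have hba : B b a = -1 := by rw [alt_symm B halt, hab]
  have := hxy (y - B a y • b + B b y • a) ⟨⟨A.add_mem (A.sub_mem hy (A.smul_mem _ hb)) (A.smul_mem _ ha), by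
    simp [hab, halt]⟩, by simp [hba, halt]⟩
  rw [alt_symm B halt a] at hxa
  rw [alt_symm B halt b] at hxb
  simp only [neg_eq_zero] at hxa hxb
  simpa [hxa, hxb] using this
end

section
variable {k : Type*} [Field k] [Fintype k] {V : Type*} [AddCommGroup V] [Module k V] [FiniteDimensional k V]
variable (B : V →ₗ[k] V →ₗ[k] k)

/-- the linear map attached to six vectors -/
def iota (b : Fin 6 → V) : (Fin 6 → k) →ₗ[k] V := Fintype.linearCombination k b

lemma iota_apply (b : Fin 6 → V) (x : Fin 6 → k) :
    iota b x = x 0 • b 0 + x 1 • b 1 + x 2 • b 2 + x 3 • b 3 + x 4 • b 4 + x 5 • b 5 := by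
  rw [iota, Fintype.linearCombination_apply, Fin.sum_univ_six]

lemma iota_isometry (halt : ∀ v, B v v = 0) (b : Fin 6 → V)
    (h01 : B (b 0) (b 1) = 1) (h23 : B (b 2) (b 3) = 1) (h45 : B (b 4) (b 5) = 1)
    (h02 : B (b 0) (b 2) = 0) (h03 : B (b 0) (b 3) = 0) (h12 : B (b 1) (b 2) = 0) (h13 : B (b 1) (b 3) = 0)
    (h40 : B (b 4) (b 0) = 0) (h41 : B (b 4) (b 1) = 0) (h42 : B (b 4) (b 2) = 0) (h43 : B (b 4) (b 3) = 0)
    (h50 : B (b 5) (b 0) = 0) (h51 : B (b 5) (b 1) = 0) (h52 : B (b 5) (b 2) = 0) (h53 : B (b 5) (b 3) = 0)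
    (x y : Fin 6 → k) : B (iota b x) (iota b y) = B6 x y := by
  have s := alt_symm B halt
  have h10 : B (b 1) (b 0) = -1 := by rw [s, h01]
  have h32 : B (b 3) (b 2) = -1 := by rw [s, h23]
  have h54 : B (b 5) (b 4) = -1 := by rw [s, h45]
  have h20 : B (b 2) (b 0) = 0 := by rw [s, h02, neg_zero]
  have h30 : B (b 3) (b 0) = 0 := by rw [s, h03, neg_zero]
  have h21 : B (b 2) (b 1) = 0 := by rw [s, h12, neg_zero]
  have h31 : B (b 3) (b 1) = 0 := by rw [s, h13, neg_zero]
  have h04 : B (b 0) (b 4) = 0 := by rw [s, h40, neg_zero]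
  have h14 : B (b 1) (b 4) = 0 := by rw [s, h41, neg_zero]
  have h24 : B (b 2) (b 4) = 0 := by rw [s, h42, neg_zero]
  have h34 : B (b 3) (b 4) = 0 := by rw [s, h43, neg_zero]
  have h05 : B (b 0) (b 5) = 0 := by rw [s, h50, neg_zero]
  have h15 : B (b 1) (b 5) = 0 := by rw [s, h51, neg_zero]
  have h25 : B (b 2) (b 5) = 0 := by rw [s, h52, neg_zero]
  have h35 : B (b 3) (b 5) = 0 := by rw [s, h53, neg_zero]
  rw [iota_apply, iota_apply, B6_eq]
  simp only [map_add, map_smul, LinearMap.add_apply, LinearMap.smul_apply, smul_eq_mul, halt, h01, h23, h45,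
    h02, h03, h12, h13, h40, h41, h42, h43, h50, h51, h52, h53, h10, h32, h54, h20, h30, h21, h31, h04, h14, h24, h34,
    h05, h15, h25, h35]
  ring

/-- radical -/
def rad (U : Submodule k V) : Submodule k V := U ⊓ LinearMap.BilinForm.orthogonal B U

lemma mem_rad (U : Submodule k V) (x : V) : x ∈ rad B U ↔ x ∈ U ∧ ∀ y ∈ U, B y x = 0 := by
  rw [rad, Submodule.mem_inf, LinearMap.BilinForm.mem_orthogonal_iff]

lemma reduction (p t m r : ℕ) [Fact p.Prime] [CharP k p] (hodd : Odd p) (hk : Fintype.card k = p ^ t)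
    (hdim : Module.finrank k V = 2 * m) (halt : ∀ v, B v v = 0)
    (hnondeg : ∀ v, (∀ w, B v w = 0) → v = 0) (hrm : r < m)
    (F : ({Z : Submodule k V // Module.finrank k Z = 1} → k) →ₗ[k] k)
    (hF : ∀ W : Submodule k V, (∀ u ∈ W, ∀ w ∈ W, B u w = 0) → Module.finrank k W = r → F (chiFun W) = 0) :
    ∀ (n : ℕ) (U : Submodule k V), Module.finrank k U = r →
      Module.finrank k V - Module.finrank k (rad B U) = n → F (chiFun U) = 0 := by
  have s := alt_symm B halt
  have hnd : LinearMap.BilinForm.Nondegenerate B := by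
    constructor
    · intro v hv; exact hnondeg v hv
    · intro v hv; exact hnondeg v fun w => by rw [s, hv w, neg_zero]
  have hrefl : LinearMap.BilinForm.IsRefl B := by
    intro x y h; rw [s, h, neg_zero]
  intro n
  induction n using Nat.strong_induction_on with
  | _ n ih =>
  intro U hU hn
  by_cases hiso : ∀ u ∈ U, ∀ w ∈ U, B u w = 0
  · exact hF U hiso hU
  push Not at hiso
  obtain ⟨e3, he3, f0, hf0, hne⟩ := hiso
  obtain ⟨f3, hf3, hB3⟩ : ∃ f3 ∈ U, B e3 f3 = 1 :=
    ⟨(B e3 f0)⁻¹ • f0, U.smul_mem _ hf0, by rw [map_smul, smul_eq_mul, inv_mul_cancel₀ hne]⟩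
  have hB3' : B f3 e3 = -1 := by rw [s, hB3]
  set U' : Submodule k V := U ⊓ LinearMap.ker (B e3) ⊓ LinearMap.ker (B f3) with hU'
  have hU'mem : ∀ x, x ∈ U' ↔ x ∈ U ∧ B e3 x = 0 ∧ B f3 x = 0 := by
    intro x; simp [hU', and_assoc]
  have hL : ∀ x y : k, x • e3 + y • f3 ∈ U' → x = 0 ∧ y = 0 := by
    intro x y h
    obtain ⟨-, h1, h2⟩ := (hU'mem _).mp h
    simp [halt, hB3, hB3'] at h1 h2
    exact ⟨h2, h1⟩
  have hUeq : Submodule.span k {e3, f3} ⊔ U' = U := by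
    apply le_antisymm
    · refine sup_le ?_ ?_
      · rw [Submodule.span_le]
        rintro x (rfl | rfl)
        · exact he3
        · exact hf3
      · intro x hx; exact ((hU'mem x).mp hx).1
    · intro x hx
      refine Submodule.mem_sup.mpr ⟨-(B f3 x) • e3 + (B e3 x) • f3, Submodule.mem_span_pair.mpr ⟨_, _, rfl⟩,
        x - (-(B f3 x) • e3 + (B e3 x) • f3), (hU'mem _).mpr ⟨?_, ?_, ?_⟩, by abel⟩
      · exact U.sub_mem hx (U.add_mem (U.smul_mem _ he3) (U.smul_mem _ hf3))
      · simp [halt, hB3]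
      · simp [halt, hB3']
  have hr := finrank_plane e3 f3 U' hL
  rw [hUeq, hU] at hr
  let A0 : Submodule k V := LinearMap.BilinForm.orthogonal B U'
  have hA0mem : ∀ x, x ∈ A0 ↔ ∀ y ∈ U', B y x = 0 := fun x => LinearMap.BilinForm.mem_orthogonal_iff
  have hA0 : ∀ a ∈ A0, (∀ b ∈ A0, B a b = 0) → a ∈ U' := by
    intro a _ h
    rw [← LinearMap.BilinForm.orthogonal_orthogonal hnd hrefl U', LinearMap.BilinForm.mem_orthogonal_iff]
    intro b hb
    show B b a = 0
    rw [s, h b hb, neg_zero]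
  have hA0r : Module.finrank k A0 = 2 * m - Module.finrank k U' := by
    rw [LinearMap.BilinForm.finrank_orthogonal hnd, hdim]
  have he3A : e3 ∈ A0 := (hA0mem _).mpr fun y hy => by rw [s, ((hU'mem y).mp hy).2.1, neg_zero]
  have hf3A : f3 ∈ A0 := (hA0mem _).mpr fun y hy => by rw [s, ((hU'mem y).mp hy).2.2, neg_zero]
  have hA1 := step_hyp B halt A0 U' hA0 e3 f3 he3A hf3A hB3
  set A1 := A0 ⊓ LinearMap.ker (B e3) ⊓ LinearMap.ker (B f3) with hA1def
  have hA1r : Module.finrank k A0 ≤ Module.finrank k A1 + 2 := by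
    have h1 := finrank_inf_ker A0 (B e3)
    have h2 := finrank_inf_ker (A0 ⊓ LinearMap.ker (B e3)) (B f3)
    rw [← hA1def] at h2
    omega
  obtain ⟨e1, he1, f1, hf1, hB1⟩ := exists_hyp B A1 U' hA1 (by omega)
  have hA2 := step_hyp B halt A1 U' hA1 e1 f1 he1 hf1 hB1
  set A2 := A1 ⊓ LinearMap.ker (B e1) ⊓ LinearMap.ker (B f1) with hA2def
  have hA2r : Module.finrank k A1 ≤ Module.finrank k A2 + 2 := by
    have h1 := finrank_inf_ker A1 (B e1)
    have h2 := finrank_inf_ker (A1 ⊓ LinearMap.ker (B e1)) (B f1)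
    rw [← hA2def] at h2
    omega
  obtain ⟨e2, he2, f2, hf2, hB2⟩ := exists_hyp B A2 U' hA2 (by omega)
  have hA1mem : ∀ x, x ∈ A1 ↔ x ∈ A0 ∧ B e3 x = 0 ∧ B f3 x = 0 := by
    intro x; simp [hA1def, and_assoc]
  have hA2mem : ∀ x, x ∈ A2 ↔ x ∈ A1 ∧ B e1 x = 0 ∧ B f1 x = 0 := by
    intro x; simp [hA2def, and_assoc]
  rw [hA2mem, hA1mem] at he2 hf2
  rw [hA1mem] at he1 hf1
  let b : Fin 6 → V := ![e1, f1, e2, f2, e3, f3]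
  have hiso := iota_isometry B halt b hB1 hB2 hB3 he2.2.1 hf2.2.1 he2.2.2 hf2.2.2
    he1.2.1 hf1.2.1 he2.1.2.1 hf2.1.2.1 he1.2.2 hf1.2.2 he2.1.2.2 hf2.1.2.2
  let ι : (Fin 6 → k) →ₗ[k] V := iota b
  have hιA : ∀ x, ι x ∈ A0 := by
    intro x
    show iota b x ∈ A0
    rw [iota_apply]
    refine A0.add_mem (A0.add_mem (A0.add_mem (A0.add_mem (A0.add_mem ?_ ?_) ?_) ?_) ?_) ?_ <;> apply A0.smul_mem
    exacts [he1.1, hf1.1, he2.1.1, hf2.1.1, he3A, hf3A]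
  have hιU : ∀ x, ι x ∈ U' → x = 0 := by
    intro x hx
    have h0 : ∀ y, B6 x y = 0 := by
      intro y
      rw [← hiso]
      exact (hA0mem _).mp (hιA y) _ hx
    have g0 := h0 (Pi.single 0 1)
    have g1 := h0 (Pi.single 1 1)
    have g2 := h0 (Pi.single 2 1)
    have g3 := h0 (Pi.single 3 1)
    have g4 := h0 (Pi.single 4 1)
    have g5 := h0 (Pi.single 5 1)
    simp [B6_eq] at g0 g1 g2 g3 g4 g5
    ext i; fin_cases i <;> simp [g0, g1, g2, g3, g4, g5]
  let φ : (Fin 6 → k) → k := fun x => if x = 0 then 0 else F (chiFun (Submodule.span k {ι x} ⊔ U'))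
  have hsum : ∀ u v : Fin 6 → k, (∀ x y : k, x • u + y • v = 0 → x = 0 ∧ y = 0) →
      ∑ x : k, ∑ y : k, φ (x • u + y • v) = - F (chiFun (Submodule.span k {ι u, ι v} ⊔ U')) := by
    intro u v huv
    have h1 := chi_plane (ι u) (ι v) U' (by
      intro x y h
      apply huv
      apply hιU
      simpa using h)
    rw [← map_neg, ← h1, map_sum, ← Fintype.sum_prod_type']
    refine Finset.sum_congr rfl fun w _ => ?_
    obtain ⟨x, y⟩ := w
    by_cases hw : ((x, y) : k × k) = 0
    · obtain ⟨rfl, rfl⟩ := Prod.mk_eq_zero.mp hw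
      simp [φ]
    · have hw' : x • u + y • v ≠ 0 := fun h => hw (by simpa using huv x y h)
      simp [φ, hw', hw]
  have hadm : Adm φ := by
    refine ⟨by simp [φ], ?_, ?_⟩
    · intro c z hc
      have e : Submodule.span k {ι (c • z)} = Submodule.span k {ι z} := by
        rw [map_smul]
        exact Submodule.span_singleton_smul_eq (IsUnit.mk0 c hc) _
      simp only [φ, e, smul_eq_zero, hc, false_or]
    · intro u v hli hB
      rw [LinearIndependent.pair_iff] at hli
      rw [hsum u v hli, neg_eq_zero]
      set W := Submodule.span k {ι u, ι v} ⊔ U' with hW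
      have hcond : ∀ x y : k, x • ι u + y • ι v ∈ U' → x = 0 ∧ y = 0 := by
        intro x y h
        apply hli
        apply hιU
        simpa using h
      have hWr : Module.finrank k W = r := by
        rw [hW, finrank_plane _ _ _ hcond, hr]
      have huW : ι u ∈ W := Submodule.mem_sup_left (Submodule.subset_span (by simp))
      have hWperp : ∀ x, (B (ι u) x = 0) → B (ι v) x = 0 → (∀ y ∈ U', B y x = 0) → ∀ y ∈ W, B y x = 0 := by
        intro x h1 h2 h3 y hy
        obtain ⟨y1, hy1, y2, hy2, rfl⟩ := Submodule.mem_sup.mp hy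
        obtain ⟨c, d, rfl⟩ := Submodule.mem_span_pair.mp hy1
        simp [h1, h2, h3 y2 hy2]
      have hle : rad B U ≤ rad B W := by
        intro x hx
        rw [mem_rad] at hx ⊢
        have hxU' : x ∈ U' := (hU'mem x).mpr ⟨hx.1, hx.2 _ he3, hx.2 _ hf3⟩
        refine ⟨Submodule.mem_sup_right hxU', hWperp x ?_ ?_ ?_⟩
        · rw [s, (hA0mem _).mp (hιA u) x hxU', neg_zero]
        · rw [s, (hA0mem _).mp (hιA v) x hxU', neg_zero]
        · intro y hy; exact hx.2 y ((hU'mem y).mp hy).1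
      have hlt : rad B U < rad B W := by
        refine lt_of_le_of_ne hle fun heq => ?_
        have h1 : ι u ∈ rad B W := by
          rw [mem_rad]
          refine ⟨huW, hWperp _ (halt _) ?_ ((hA0mem _).mp (hιA u))⟩
          rw [s, hiso, hB, neg_zero]
        rw [← heq, mem_rad] at h1
        have h2 : ι u ∈ U' := (hU'mem _).mpr ⟨h1.1, h1.2 _ he3, h1.2 _ hf3⟩
        have := hcond 1 0 (by simpa using h2)
        exact one_ne_zero this.1
      have hfl := Submodule.finrank_lt_finrank_of_lt hlt
      have hfl2 := Submodule.finrank_le (rad B W)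
      exact ih _ (by omega) W hWr rfl
  have hcore := core p t hodd hk hadm
  have e4 : ∀ x y : k, (![0, 0, 0, 0, x, y] : Fin 6 → k) = x • (Pi.single 4 1 : Fin 6 → k) + y • (Pi.single 5 1 : Fin 6 → k) := by
    intro x y
    ext i; fin_cases i <;> simp [Matrix.vecHead, Matrix.vecTail]
  simp only [e4] at hcore
  rw [hsum, neg_eq_zero] at hcore
  · have i4 : ι (Pi.single 4 1) = e3 := by
      show iota b _ = _
      rw [iota_apply]; simp [b]
    have i5 : ι (Pi.single 5 1) = f3 := by
      show iota b _ = _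
      rw [iota_apply]; simp [b]
    rw [i4, i5, hUeq] at hcore
    exact hcore
  · intro x y h
    have h4 := congrFun h 4
    have h5 := congrFun h 5
    simp at h4 h5
    exact ⟨h4, h5⟩
end

/-- For `1 ≤ r < m`, the `F_q`-span of the characteristic functions of the totally
isotropic `r`-dimensional subspaces of a `2m`-dimensional symplectic space `V` over
`F_q` (`q = p^t`, `p` odd) equals the `F_q`-span of the characteristic functions of
all `r`-dimensional subspaces of `V`. -/
theorem span_isotropic_eq_span_all (p t m : ℕ) [Fact p.Prime]
    (hodd : Odd p) (ht : 1 ≤ t) (hm : 2 ≤ m)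
    (V : Type) [AddCommGroup V] [Module (GaloisField p t) V]
    [FiniteDimensional (GaloisField p t) V]
    (hdim : Module.finrank (GaloisField p t) V = 2 * m)
    (B : V →ₗ[GaloisField p t] V →ₗ[GaloisField p t] GaloisField p t)
    (halt : ∀ v, B v v = 0)
    (hnondeg : ∀ v, (∀ w, B v w = 0) → v = 0)
    (r : ℕ) (hr1 : 1 ≤ r) (hrm : r < m) :
    Submodule.span (GaloisField p t)
        {f | ∃ W : Submodule (GaloisField p t) V,
          (∀ u ∈ W, ∀ w ∈ W, B u w = 0) ∧ Module.finrank (GaloisField p t) W = r ∧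
            f = chiFun W} =
      Submodule.span (GaloisField p t)
        {f | ∃ U : Submodule (GaloisField p t) V,
          Module.finrank (GaloisField p t) U = r ∧ f = chiFun U} := by
  apply le_antisymm
  · apply Submodule.span_mono
    rintro f ⟨W, -, h1, h2⟩
    exact ⟨W, h1, h2⟩
  · rw [Submodule.span_le]
    rintro f ⟨U, hU, rfl⟩
    letI : Fintype (GaloisField p t) := Fintype.ofFinite _
    have hk : Fintype.card (GaloisField p t) = p ^ t := by
      rw [← Nat.card_eq_fintype_card]; exact GaloisField.card p t (by omega)
    rw [SetLike.mem_coe, ← Subspace.forall_mem_dualAnnihilator_apply_eq_zero_iff]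
    intro F hF
    rw [Submodule.mem_dualAnnihilator] at hF
    refine reduction B p t m r hodd hk hdim halt hnondeg hrm F ?_ _ U hU rfl
    intro W hW hWr
    exact hF _ (Submodule.subset_span ⟨W, hW, hWr, rfl⟩)

end
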